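/- arXiv:1303.5601 — 3 statements merged into one kernel-verified Lean document; each statement's English description precedes it below -/
import Mathlib

section
/- There exists a nontrivial graph property on 5 vertices that is nonevasive; more precisely, there is a set P of simple graphs on 5 vertices, closed under isomorphism, with P ≠ ∅ and P ≠ univ, such that some edge-query decision tree of depth at most 9 (which is strictly less than C(5,2) = 10) computes the indicator function of P. -/
/-- An edge-query decision tree on `n` vertices: either a leaf labeled with a
Boolean, or an internal node labeled with a pair of distinct vertices together
with two subtrees. -/
inductive EdgeTree (n : ℕ) : Type where
  | leaf (b : Bool) : EdgeTree n
  | node (u v : Fin n) (huv : u ≠ v) (tYes tNo : EdgeTree n) : EdgeTree n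

open Classical in
/-- Evaluate a decision tree on a graph `G`: at each internal node, branch to
the first subtree if the queried pair is an edge of `G` and to the second
subtree otherwise; return the Boolean at the leaf reached. -/
noncomputable def EdgeTree.eval {n : ℕ} : EdgeTree n → SimpleGraph (Fin n) → Bool
  | .leaf b, _ => b
  | .node u v _ tYes tNo, G => if G.Adj u v then tYes.eval G else tNo.eval G

/-- The depth of a decision tree: the maximal number of internal nodes on a
root-to-leaf path. -/
def EdgeTree.depth {n : ℕ} : EdgeTree n → ℕ
  | .leaf _ => 0
  | .node _ _ _ tYes tNo => 1 + max tYes.depth tNo.depth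

/-- A decision tree computes (the indicator function of) a set `P` of graphs if
it evaluates to `true` on `G` exactly when `G ∈ P`. -/
def EdgeTree.Computes {n : ℕ} (t : EdgeTree n) (P : Set (SimpleGraph (Fin n))) : Prop :=
  ∀ G : SimpleGraph (Fin n), t.eval G = true ↔ G ∈ P

/-- A set of graphs is closed under isomorphism. -/
def IsoClosed {n : ℕ} (P : Set (SimpleGraph (Fin n))) : Prop :=
  ∀ G H : SimpleGraph (Fin n), Nonempty (G ≃g H) → G ∈ P → H ∈ P

namespace EdgeTree

/-- Evaluation of a decision tree on a Boolean adjacency matrix. -/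
def evalMatrix {n : ℕ} : EdgeTree n → (Fin n → Fin n → Bool) → Bool
  | .leaf b, _ => b
  | .node u v _ tYes tNo, A => bif A u v then tYes.evalMatrix A else tNo.evalMatrix A

theorem eval_eq_evalMatrix {n : ℕ} (t : EdgeTree n) (G : SimpleGraph (Fin n))
    [DecidableRel G.Adj] : t.eval G = t.evalMatrix fun u v => decide (G.Adj u v) := by
  induction t with
  | leaf b => rfl
  | node u v _ tYes tNo ihYes ihNo =>
    by_cases h : G.Adj u v <;> simp [eval, evalMatrix, h, ihYes, ihNo]

/-- The tree that queries `uv` and then continues with `tYes` or `tNo`. -/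
def ask {n : ℕ} (u v : Fin n) (tYes tNo : EdgeTree n) : EdgeTree n :=
  if h : u = v then tNo else node u v h tYes tNo

/-- The tree accepting every graph. -/
abbrev yes {n : ℕ} : EdgeTree n := leaf true

/-- The tree rejecting every graph. -/
abbrev no {n : ℕ} : EdgeTree n := leaf false

/-- The tree deciding whether `uv` is an edge. -/
def edge {n : ℕ} (u v : Fin n) : EdgeTree n := ask u v yes no

/-- The tree deciding whether `uv` is not an edge. -/
def nonedge {n : ℕ} (u v : Fin n) : EdgeTree n := ask u v no yes

/-- A decision tree of depth 9 for membership of the degree sequence in `goodDegrees`. -/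
def goodDegreesTree : EdgeTree 5 :=
  ask 0 1
    (ask 0 2
      (ask 0 3
        (ask 1 4
          (ask 2 4
            (ask 0 4 (ask 1 3 no (ask 2 3 no (nonedge 3 4))) no)
            (ask 1 2
              (ask 3 4 no (ask 1 3 (nonedge 0 4) (nonedge 2 3)))
              (ask 3 4 (ask 0 4 (nonedge 2 3) no) (ask 1 3 (nonedge 2 3) (edge 0 4)))))
          (ask 2 4
            (ask 1 2
              (ask 3 4 no (ask 2 3 (nonedge 0 4) (nonedge 1 3)))
              (ask 3 4 (ask 0 4 (nonedge 1 3) no) (ask 2 3 (nonedge 1 3) (edge 0 4))))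
            (ask 3 4
              (ask 1 3 (ask 2 3 (nonedge 0 4) (nonedge 1 2)) (ask 2 3 (nonedge 1 2) (edge 0 4)))
              yes)))
        (ask 1 4
          (ask 2 3
            (ask 1 2 (ask 3 4 no (ask 2 4 (nonedge 1 3) (nonedge 0 4))) no)
            (ask 1 3
              (ask 2 4 (ask 1 2 (nonedge 3 4) no) (ask 0 4 (nonedge 3 4) (edge 1 2)))
              (ask 2 4 (ask 0 4 yes (nonedge 3 4)) (ask 1 2 (nonedge 3 4) (edge 0 4)))))
          (ask 1 3
            (ask 3 4 no (ask 2 4 (ask 0 4 no (edge 1 2)) (ask 2 3 (nonedge 0 4) (edge 1 2))))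
            (ask 2 4
              (ask 2 3 (ask 0 4 (nonedge 3 4) (edge 1 2)) (ask 1 2 (nonedge 3 4) (edge 0 4)))
              (ask 3 4 no (ask 2 3 (edge 1 2) (edge 0 4)))))))
      (ask 3 4
        (ask 1 3
          (ask 0 4
            (ask 1 2
              (ask 1 4 (ask 2 3 no (nonedge 2 4)) no)
              (ask 2 3 (ask 0 3 (nonedge 2 4) no) (ask 1 4 yes (nonedge 2 4))))
            (ask 2 3
              (ask 1 2 (ask 1 4 (nonedge 0 3) (nonedge 2 4)) (ask 1 4 (nonedge 2 4) (edge 0 3)))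
              (ask 0 3 (nonedge 2 4) (edge 1 4))))
          (ask 0 3
            (ask 1 2 no (ask 2 4 (ask 0 4 (nonedge 2 3) no) (ask 1 4 (nonedge 2 3) (edge 0 4))))
            (ask 1 4 (ask 2 4 (ask 1 2 (nonedge 2 3) (edge 0 4)) (ask 0 4 (nonedge 2 3) no)) no)))
        (ask 2 3
          (ask 0 3
            (ask 2 4 no (ask 1 4 (ask 0 4 no (edge 1 3)) (ask 1 2 (nonedge 0 4) (edge 1 3))))
            (ask 1 2 (ask 1 4 (ask 2 4 (nonedge 0 4) (edge 1 3)) (ask 0 4 no (edge 1 3))) no))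
          (ask 0 4
            (ask 1 3
              (ask 0 3 (nonedge 2 4) (edge 1 4))
              (ask 1 2 (ask 2 4 (nonedge 0 3) (edge 1 4)) (ask 2 4 (edge 1 4) (edge 0 3))))
            (ask 1 2
              (ask 1 3 (ask 1 4 yes (nonedge 2 4)) (ask 0 3 no (edge 1 4)))
              (ask 1 3 (ask 1 4 (nonedge 2 4) no) no))))))
    (ask 0 2
      (ask 3 4
        (ask 2 3
          (ask 0 4
            (ask 1 2
              (ask 1 3 no (ask 1 4 no (edge 2 4)))
              (ask 1 3 (ask 0 3 (nonedge 1 4) no) (ask 1 4 (edge 2 4) yes)))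
            (ask 1 3
              (ask 1 2 (ask 2 4 (nonedge 0 3) (nonedge 1 4)) (ask 2 4 (nonedge 1 4) (edge 0 3)))
              (ask 0 3 (nonedge 1 4) (edge 2 4))))
          (ask 0 3
            (ask 1 2 no (ask 1 4 (ask 0 4 (nonedge 1 3) no) (ask 2 4 (nonedge 1 3) (edge 0 4))))
            (ask 2 4 (ask 1 4 (ask 1 2 (nonedge 1 3) (edge 0 4)) (ask 0 4 (nonedge 1 3) no)) no)))
        (ask 1 3
          (ask 0 3
            (ask 1 4 no (ask 2 4 (ask 0 4 no (edge 2 3)) (ask 1 2 (nonedge 0 4) (edge 2 3))))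
            (ask 1 2 (ask 2 4 (ask 1 4 (nonedge 0 4) (edge 2 3)) (ask 0 4 no (edge 2 3))) no))
          (ask 0 4
            (ask 2 3
              (ask 0 3 (nonedge 1 4) (edge 2 4))
              (ask 1 2 (ask 1 4 (nonedge 0 3) (edge 2 4)) (ask 1 4 (edge 2 4) (edge 0 3))))
            (ask 1 2
              (ask 2 3 (ask 1 4 (edge 2 4) yes) (ask 0 3 no (edge 2 4)))
              (ask 1 4 no (ask 2 3 (edge 2 4) no))))))
      (ask 0 3
        (ask 1 4
          (ask 1 3
            (ask 2 4
              (ask 3 4 (ask 2 3 (nonedge 0 4) (nonedge 1 2)) no)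
              (ask 2 3 (ask 1 2 (nonedge 0 4) (edge 3 4)) (ask 0 4 (nonedge 1 2) (edge 3 4))))
            (ask 3 4 (ask 2 4 (ask 2 3 (nonedge 1 2) (edge 0 4)) (ask 0 4 (nonedge 1 2) no)) no))
          (ask 2 3
            (ask 1 3
              (ask 2 4 (ask 1 2 (nonedge 0 4) (edge 3 4)) (ask 0 4 (edge 3 4) yes))
              (ask 2 4 (ask 0 4 (nonedge 1 2) (edge 3 4)) (ask 1 2 no (edge 3 4))))
            (ask 1 2 no (ask 3 4 (ask 2 4 (edge 0 4) (edge 1 3)) no))))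
        (ask 1 4
          (ask 2 4
            (ask 3 4
              yes
              (ask 1 3 (ask 2 3 (nonedge 0 4) (edge 1 2)) (ask 2 3 (edge 1 2) (edge 0 4))))
            (ask 1 2
              (ask 3 4 (ask 2 3 (nonedge 0 4) (edge 1 3)) (ask 0 4 no (edge 1 3)))
              (ask 3 4 (ask 2 3 (edge 1 3) (edge 0 4)) no)))
          (ask 2 4
            (ask 1 2
              (ask 3 4 (ask 1 3 (nonedge 0 4) (edge 2 3)) (ask 0 4 no (edge 2 3)))
              (ask 3 4 (ask 1 3 (edge 2 3) (edge 0 4)) no))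
            (ask 0 4 no (ask 1 3 (ask 2 3 (edge 3 4) no) no))))))

end EdgeTree

/-- The degree sequences of the bull, of `K₁ ⊔ H` for `H` a connected graph on four vertices of
diameter at most two, and of the complements of the latter graphs. -/
def goodDegrees : List (List ℕ) :=
  [[0, 1, 1, 1, 3], [0, 1, 2, 2, 3], [0, 2, 2, 2, 2], [0, 2, 2, 3, 3], [0, 3, 3, 3, 3],
    [1, 1, 1, 1, 4], [1, 1, 2, 2, 4], [1, 2, 2, 3, 4], [1, 3, 3, 3, 4], [2, 2, 2, 2, 4],
    [1, 1, 2, 3, 3]]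

open Classical in
/-- The multiset of vertex degrees of a graph. -/
noncomputable def SimpleGraph.degreeMultiset {V : Type*} [Fintype V] (G : SimpleGraph V) :
    Multiset ℕ :=
  Finset.univ.val.map fun v => G.degree v

theorem SimpleGraph.Iso.degreeMultiset_eq {V W : Type*} [Fintype V] [Fintype W]
    {G : SimpleGraph V} {H : SimpleGraph W} (f : G ≃g H) :
    G.degreeMultiset = H.degreeMultiset := by
  classical
  unfold SimpleGraph.degreeMultiset
  rw [← Finset.map_univ_equiv f.toEquiv, Finset.map_val, Multiset.map_map]
  exact Multiset.map_congr rfl fun v _ => (f.degree_eq v).symm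

theorem isoClosed_setOf_degreeMultiset {n : ℕ} (p : Multiset ℕ → Prop) :
    IsoClosed {G : SimpleGraph (Fin n) | p G.degreeMultiset} := by
  rintro G H ⟨f⟩ hG
  simpa [← f.degreeMultiset_eq] using hG

theorem SimpleGraph.degreeMultiset_eq_ofFn {n : ℕ} (G : SimpleGraph (Fin n))
    [DecidableRel G.Adj] :
    G.degreeMultiset =
      List.ofFn fun v => (List.ofFn fun w => (decide (G.Adj v w)).toNat).sum := by
  have h : ∀ v, G.degree v = (List.ofFn fun w => (decide (G.Adj v w)).toNat).sum := by
    intro v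
    rw [List.sum_ofFn, ← G.card_neighborFinset_eq_degree, G.neighborFinset_eq_filter,
      Finset.card_filter]
    exact Finset.sum_congr rfl fun w _ => by by_cases h : G.Adj v w <;> simp [h]
  rw [degreeMultiset, Fin.univ_val_map]
  congr 2
  funext v
  rw [← h v]
  congr!

/-- The adjacency matrix on five vertices with the given entries above the diagonal. -/
def adjacencyMatrixOfBools (a b c d e f g h i j : Bool) : Fin 5 → Fin 5 → Bool :=
  ![![false, a, b, c, d], ![a, false, e, f, g], ![b, e, false, h, i], ![c, f, h, false, j],
    ![d, g, i, j, false]]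

theorem SimpleGraph.exists_adj_eq_adjacencyMatrixOfBools (G : SimpleGraph (Fin 5))
    [DecidableRel G.Adj] : ∃ a b c d e f g h i j : Bool, ∀ u v,
      decide (G.Adj u v) = adjacencyMatrixOfBools a b c d e f g h i j u v := by
  refine ⟨decide (G.Adj 0 1), decide (G.Adj 0 2), decide (G.Adj 0 3), decide (G.Adj 0 4),
    decide (G.Adj 1 2), decide (G.Adj 1 3), decide (G.Adj 1 4), decide (G.Adj 2 3),
    decide (G.Adj 2 4), decide (G.Adj 3 4), fun u v => ?_⟩
  fin_cases u <;> fin_cases v <;> simp [adjacencyMatrixOfBools] <;>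
    exact G.adj_comm _ _

/-- The row sums of `adjacencyMatrixOfBools`. -/
def degreesOfBools (a b c d e f g h i j : Bool) : List ℕ :=
  [[false, a, b, c, d], [a, false, e, f, g], [b, e, false, h, i], [c, f, h, false, j],
    [d, g, i, j, false]].map fun r => (r.map Bool.toNat).sum

theorem ofFn_sum_adjacencyMatrixOfBools (a b c d e f g h i j : Bool) :
    (List.ofFn fun v => (List.ofFn fun w =>
      (adjacencyMatrixOfBools a b c d e f g h i j v w).toNat).sum) =
        degreesOfBools a b c d e f g h i j :=
  rfl

theorem EdgeTree.evalMatrix_goodDegreesTree : ∀ a b c d e f g h i j : Bool,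
    goodDegreesTree.evalMatrix (adjacencyMatrixOfBools a b c d e f g h i j) =
      goodDegrees.any (degreesOfBools a b c d e f g h i j).isPerm := by
  decide +kernel

theorem EdgeTree.goodDegreesTree_computes :
    goodDegreesTree.Computes
      {G | ∃ l ∈ goodDegrees, G.degreeMultiset = (l : Multiset ℕ)} := by
  classical
  intro G
  obtain ⟨a, b, c, d, e, f, g, h, i, j, hA⟩ := G.exists_adj_eq_adjacencyMatrixOfBools
  simp only [Set.mem_ofPred_eq, eval_eq_evalMatrix, G.degreeMultiset_eq_ofFn, Multiset.coe_eq_coe,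
    hA, ofFn_sum_adjacencyMatrixOfBools]
  rw [evalMatrix_goodDegreesTree]
  simp [List.isPerm_iff]

/-- There exists a nontrivial graph property on 5 vertices that is nonevasive:
some edge-query decision tree of depth at most 9 < C(5,2) = 10 computes it. -/
theorem smallest_nonevasive_exists :
    ∃ P : Set (SimpleGraph (Fin 5)), IsoClosed P ∧ P ≠ ∅ ∧ P ≠ Set.univ ∧
      ∃ t : EdgeTree 5, t.depth ≤ 9 ∧ t.Computes P := by
  have hmem (b : Bool) : ∃ G : SimpleGraph (Fin 5), EdgeTree.goodDegreesTree.eval G = b := by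
    cases b
    · refine ⟨⊥, ?_⟩
      rw [EdgeTree.eval_eq_evalMatrix]
      decide +kernel
    · refine ⟨SimpleGraph.fromRel fun u _ => u = 0, ?_⟩
      rw [EdgeTree.eval_eq_evalMatrix]
      decide +kernel
  refine ⟨{G | ∃ l ∈ goodDegrees, G.degreeMultiset = (l : Multiset ℕ)},
    isoClosed_setOf_degreeMultiset fun s => ∃ l ∈ goodDegrees, s = (l : Multiset ℕ), ?_, ?_,
    EdgeTree.goodDegreesTree, by decide +kernel, EdgeTree.goodDegreesTree_computes⟩
  · obtain ⟨G, hG⟩ := hmem true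
    exact Set.Nonempty.ne_empty ⟨G, (EdgeTree.goodDegreesTree_computes G).1 hG⟩
  · obtain ⟨G, hG⟩ := hmem false
    refine (Set.ne_univ_iff_exists_notMem _).2 ⟨G, fun h => ?_⟩
    simp [(EdgeTree.goodDegreesTree_computes G).2 h] at hG
end

section
/- There exists a nontrivial nonevasive graph property P on 5 vertices which in addition is closed under graph complementation (G ∈ P if and only if the complement graph Gᶜ ∈ P) and which contains exactly 11 isomorphism classes of graphs. -/
/-- The number whose decimal digit at place `d` counts the vertices of degree `d`. -/
def degreeProfile (G : SimpleGraph (Fin 5)) [DecidableRel G.Adj] : ℕ :=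
  ∑ v, 10 ^ ∑ w, if G.Adj v w then 1 else 0

/-- The degree profiles of the graphs in the property. -/
def profiles : List ℕ := [401, 1031, 1211, 2120, 2201, 4001, 10040, 10220, 10400, 11210, 13010]

/-- The position of the pair `{u, v}` in the colexicographic order. -/
def edgeIndex (u v : Fin 5) : ℕ := max u.val v.val * (max u.val v.val - 1) / 2 + min u.val v.val

/-- The graph whose edges are the pairs `{u, v}` such that bit `edgeIndex u v` of `c` is set. -/
def ofCode (c : ℕ) : SimpleGraph (Fin 5) where
  Adj u v := u ≠ v ∧ c.testBit (edgeIndex u v) = true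
  symm := ⟨fun u v h => ⟨h.1.symm, by simpa only [edgeIndex, max_comm, min_comm] using h.2⟩⟩
  loopless := ⟨fun _ h => h.1 rfl⟩

instance (c : ℕ) : DecidableRel (ofCode c).Adj := fun u v =>
  inferInstanceAs (Decidable (u ≠ v ∧ c.testBit (edgeIndex u v) = true))

/-- The endpoints of the pair at a given position in the colexicographic order. -/
def edgeEnds : Fin 10 → Fin 5 × Fin 5 :=
  ![(0, 1), (0, 2), (1, 2), (0, 3), (1, 3), (2, 3), (0, 4), (1, 4), (2, 4), (3, 4)]

/-- Codes of representatives of the isomorphism classes in the property. -/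
def classCode : Fin 11 → ℕ := ![30, 11, 15, 87, 31, 63, 75, 79, 235, 95, 127]

/-- Membership in the property, on codes. -/
def codeTest (c : ℕ) : Bool := decide (degreeProfile (ofCode c) ∈ profiles)

/-- A querying strategy that ends by naming a pair which need not be queried. -/
inductive QueryPlan : Type where
  | skip (e : Fin 10) : QueryPlan
  | ask (e : Fin 10) (yes no : QueryPlan) : QueryPlan

/-- The plan obtained by interchanging edges and non-edges. -/
def QueryPlan.compl : QueryPlan → QueryPlan
  | .skip e => .skip e
  | .ask e yes no => .ask e no.compl yes.compl

/-- The strategy once the pair `{0, 1}` is known to be an edge. -/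
def edgePlan : QueryPlan :=
  .ask 1
    (.ask 4
      (.ask 6
        (.ask 5
          (.skip 2)
          (.ask 2 (.ask 7 (.skip 8) (.skip 3)) (.ask 9 (.skip 7) (.ask 7 (.skip 3) (.skip 8)))))
        (.ask 5
          (.ask 9 (.skip 2) (.skip 3))
          (.ask 8 (.skip 7) (.ask 7 (.ask 3 (.skip 2) (.skip 9)) (.ask 2 (.skip 3) (.skip 9))))))
      (.ask 7
        (.ask 8
          (.ask 5 (.skip 6) (.skip 2))
          (.ask 9 (.skip 3) (.ask 3 (.ask 2 (.skip 6) (.skip 5)) (.ask 6 (.skip 2) (.skip 5)))))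
        (.ask 5
          (.ask 8 (.ask 3 (.ask 6 (.skip 9) (.skip 2)) (.ask 6 (.skip 2) (.skip 9))) (.skip 6))
          (.ask 8 (.skip 3) (.skip 2)))))
    (.ask 9
      (.ask 4
        (.ask 6
          (.ask 5 (.skip 7) (.skip 3))
          (.ask 5 (.ask 2 (.ask 7 (.skip 8) (.skip 3)) (.ask 7 (.skip 3) (.skip 8))) (.skip 2)))
        (.ask 3
          (.ask 8 (.skip 7) (.ask 7 (.skip 6) (.skip 5)))
          (.ask 8 (.ask 2 (.skip 6) (.skip 5)) (.skip 2))))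
      (.ask 5
        (.ask 3
          (.ask 7 (.skip 2) (.ask 2 (.skip 4) (.skip 6)))
          (.ask 7 (.ask 8 (.skip 4) (.skip 6)) (.skip 8)))
        (.ask 6
          (.ask 4 (.skip 2) (.ask 2 (.ask 8 (.skip 7) (.skip 3)) (.ask 8 (.skip 3) (.skip 7))))
          (.ask 4 (.skip 3) (.skip 8)))))

/-- The strategy for the property. -/
def queryPlan : QueryPlan := .ask 0 edgePlan edgePlan.compl

/-- Whether `q` holds for all codes obtained from `c` by setting some of the bits in a list. -/
def allCompletions (q : ℕ → Bool) : List (Fin 10) → ℕ → Bool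
  | [], c => q c
  | e :: es, c => allCompletions q es c && allCompletions q es (c + 2 ^ e.val)

/-- Whether a plan is sound for `f`, when the pairs in the list `es` are still unknown and the
known edges have code `c`. -/
def QueryPlan.check (f : ℕ → Bool) : QueryPlan → List (Fin 10) → ℕ → Bool
  | .skip e, es, c =>
    es.contains e && allCompletions (fun d => f (d + 2 ^ e.val) == f d) (es.erase e) c
  | .ask e yes no, es, c =>
    es.contains e && yes.check f (es.erase e) (c + 2 ^ e.val) && no.check f (es.erase e) c

theorem queryPlan_check : queryPlan.check codeTest (List.finRange 10) 0 = true := by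
  decide +kernel

theorem codeTest_compl :
    ∀ c < 1024, codeTest c = true → degreeProfile (ofCode c)ᶜ ∈ profiles := by
  decide +kernel

theorem exists_classCode_of_antitone :
    ∀ c < 1024, codeTest c = true →
      (∀ u v : Fin 5, u ≤ v → (∑ w, if (ofCode c).Adj v w then 1 else 0) ≤
        ∑ w, if (ofCode c).Adj u w then 1 else 0) →
      ∃ i, ∃ a b : Fin 5, ∀ u v,
        (ofCode (classCode i)).Adj (Equiv.swap a b u) (Equiv.swap a b v) ↔ (ofCode c).Adj u v := by
  decide +kernel

theorem codeTest_classCode : ∀ i, codeTest (classCode i) = true := by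
  decide +kernel

theorem degreeProfile_classCode_injective :
    Function.Injective fun i => degreeProfile (ofCode (classCode i)) := by
  decide +kernel

/-- The decision tree querying all pairs in the list `es` and then applying `f`. -/
def exhaustiveTree (f : ℕ → Bool) : List (Fin 10) → ℕ → EdgeTree 5
  | [], c => .leaf (f c)
  | e :: es, c =>
    .node (edgeEnds e).1 (edgeEnds e).2 (by revert e; decide)
      (exhaustiveTree f es (c + 2 ^ e.val)) (exhaustiveTree f es c)

/-- The decision tree that follows a plan. -/
def QueryPlan.tree (f : ℕ → Bool) : QueryPlan → List (Fin 10) → ℕ → EdgeTree 5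
  | .skip e, es, c => exhaustiveTree f (es.erase e) c
  | .ask e yes no, es, c =>
    .node (edgeEnds e).1 (edgeEnds e).2 (by revert e; decide)
      (yes.tree f (es.erase e) (c + 2 ^ e.val)) (no.tree f (es.erase e) c)

open Classical in
/-- The contribution of the pair at position `e` to the code of `G`. -/
noncomputable def edgeWeight (G : SimpleGraph (Fin 5)) (e : Fin 10) : ℕ :=
  if G.Adj (edgeEnds e).1 (edgeEnds e).2 then 2 ^ e.val else 0

/-- The code of a graph. -/
noncomputable def graphCode (G : SimpleGraph (Fin 5)) : ℕ :=
  ((List.finRange 10).map (edgeWeight G)).sum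

theorem depth_exhaustiveTree (f : ℕ → Bool) (es : List (Fin 10)) (c : ℕ) :
    (exhaustiveTree f es c).depth = es.length := by
  induction es generalizing c with
  | nil => rfl
  | cons e es ih => simp [exhaustiveTree, EdgeTree.depth, ih, add_comm]

theorem eval_exhaustiveTree (f : ℕ → Bool) (es : List (Fin 10)) (c : ℕ)
    (G : SimpleGraph (Fin 5)) :
    (exhaustiveTree f es c).eval G = f (c + (es.map (edgeWeight G)).sum) := by
  induction es generalizing c with
  | nil => rfl
  | cons e es ih =>
    by_cases h : G.Adj (edgeEnds e).1 (edgeEnds e).2 <;>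
      simp [exhaustiveTree, EdgeTree.eval, edgeWeight, ih, h, add_assoc]

theorem allCompletions_apply {q : ℕ → Bool} {es : List (Fin 10)} {c : ℕ}
    (h : allCompletions q es c = true) (G : SimpleGraph (Fin 5)) :
    q (c + (es.map (edgeWeight G)).sum) = true := by
  induction es generalizing c with
  | nil => exact h
  | cons e es ih =>
    simp only [allCompletions, Bool.and_eq_true] at h
    by_cases hG : G.Adj (edgeEnds e).1 (edgeEnds e).2
    · simpa [edgeWeight, hG, add_assoc] using ih h.2
    · simpa [edgeWeight, hG] using ih h.1

theorem sum_edgeWeight_erase {es : List (Fin 10)} {e : Fin 10} (h : e ∈ es)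
    (G : SimpleGraph (Fin 5)) :
    (es.map (edgeWeight G)).sum = edgeWeight G e + ((es.erase e).map (edgeWeight G)).sum := by
  simpa using ((List.perm_cons_erase h).map (edgeWeight G)).sum_eq

theorem QueryPlan.depth_tree {f : ℕ → Bool} (p : QueryPlan) {es : List (Fin 10)} {c : ℕ}
    (h : p.check f es c = true) : (p.tree f es c).depth + 1 ≤ es.length := by
  induction p generalizing es c with
  | skip e =>
    simp only [check, Bool.and_eq_true, List.contains_iff_mem] at h
    have := List.length_pos_of_mem h.1
    simp only [tree, depth_exhaustiveTree, List.length_erase_of_mem h.1]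
    omega
  | ask e yes no ihy ihn =>
    simp only [check, Bool.and_eq_true, List.contains_iff_mem] at h
    have hy := ihy h.1.2
    have hn := ihn h.2
    rw [List.length_erase_of_mem h.1.1] at hy hn
    simp only [tree, EdgeTree.depth]
    omega

theorem QueryPlan.eval_tree {f : ℕ → Bool} (p : QueryPlan) {es : List (Fin 10)} {c : ℕ}
    (h : p.check f es c = true) (G : SimpleGraph (Fin 5)) :
    (p.tree f es c).eval G = f (c + (es.map (edgeWeight G)).sum) := by
  induction p generalizing es c with
  | skip e =>
    simp only [check, Bool.and_eq_true, List.contains_iff_mem] at h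
    have hf := allCompletions_apply h.2 G
    rw [beq_iff_eq] at hf
    rw [tree, eval_exhaustiveTree, sum_edgeWeight_erase h.1]
    by_cases hG : G.Adj (edgeEnds e).1 (edgeEnds e).2
    · simp only [edgeWeight, hG, if_true] at hf ⊢
      rw [← hf]
      ring_nf
    · simp [edgeWeight, hG]
  | ask e yes no ihy ihn =>
    simp only [check, Bool.and_eq_true, List.contains_iff_mem] at h
    rw [sum_edgeWeight_erase h.1.1]
    by_cases hG : G.Adj (edgeEnds e).1 (edgeEnds e).2
    · simp only [tree, EdgeTree.eval, hG, if_true, ihy h.1.2]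
      simp [edgeWeight, hG, add_assoc]
    · simp only [tree, EdgeTree.eval, hG, if_false, ihn h.2]
      simp [edgeWeight, hG]

theorem graphCode_eq_ofBits (G : SimpleGraph (Fin 5)) [DecidableRel G.Adj] :
    graphCode G = Nat.ofBits fun e => decide (G.Adj (edgeEnds e).1 (edgeEnds e).2) := by
  have key : ∀ (n : ℕ) (b : Fin n → Bool),
      Nat.ofBits b = ∑ e, if b e = true then 2 ^ e.val else 0 := by
    intro n
    induction n with
    | zero => intro b; simp
    | succ n ih =>
      intro b
      rw [Nat.ofBits_succ, ih, Fin.sum_univ_succ, Finset.mul_sum, add_comm]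
      congr 1
      · cases b 0 <;> simp
      · refine Finset.sum_congr rfl fun e _ => ?_
        simp [pow_succ, mul_comm]
  rw [key, Fin.sum_univ_def]
  refine congrArg List.sum (List.map_congr_left fun e _ => ?_)
  by_cases h : G.Adj (edgeEnds e).1 (edgeEnds e).2 <;> simp [edgeWeight, h]

theorem graphCode_lt (G : SimpleGraph (Fin 5)) : graphCode G < 1024 := by
  classical
  rw [graphCode_eq_ofBits]
  exact Nat.ofBits_lt_two_pow _

theorem ofCode_graphCode (G : SimpleGraph (Fin 5)) : ofCode (graphCode G) = G := by
  classical
  have key : ∀ u v : Fin 5, u ≠ v → ∃ h : edgeIndex u v < 10,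
      edgeEnds ⟨edgeIndex u v, h⟩ = (u, v) ∨ edgeEnds ⟨edgeIndex u v, h⟩ = (v, u) := by
    decide
  ext u v
  by_cases huv : u = v
  · simp [huv]
  obtain ⟨h, he⟩ := key u v huv
  have hadj : (ofCode (graphCode G)).Adj u v ↔ (graphCode G).testBit (edgeIndex u v) = true :=
    and_iff_right huv
  rw [hadj, graphCode_eq_ofBits, Nat.testBit_ofBits_lt _ _ h, decide_eq_true_iff]
  rcases he with he | he <;> rw [he]
  exact G.adj_comm v u

open Classical in
/-- The graphs on five vertices whose degree profile is listed in `profiles`. -/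
def profileProperty : Set (SimpleGraph (Fin 5)) := {G | degreeProfile G ∈ profiles}

theorem mem_profileProperty {G : SimpleGraph (Fin 5)} [DecidableRel G.Adj] :
    G ∈ profileProperty ↔ degreeProfile G ∈ profiles := by
  rw [profileProperty, Set.mem_ofPred_eq]
  convert Iff.rfl

theorem codeTest_iff (c : ℕ) : codeTest c = true ↔ ofCode c ∈ profileProperty := by
  rw [mem_profileProperty, codeTest, decide_eq_true_iff]

theorem codeTest_graphCode (G : SimpleGraph (Fin 5)) :
    codeTest (graphCode G) = true ↔ G ∈ profileProperty := by
  rw [codeTest_iff, ofCode_graphCode]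

theorem SimpleGraph.Iso.sum_adj_eq {G H : SimpleGraph (Fin 5)} [DecidableRel G.Adj]
    [DecidableRel H.Adj] (φ : G ≃g H) (v : Fin 5) :
    (∑ w, if H.Adj (φ v) w then 1 else 0) = ∑ w, if G.Adj v w then 1 else 0 := by
  rw [← Equiv.sum_comp φ.toEquiv]
  exact Finset.sum_congr rfl fun w _ => if_congr φ.map_adj_iff rfl rfl

theorem SimpleGraph.Iso.degreeProfile_eq {G H : SimpleGraph (Fin 5)} [DecidableRel G.Adj]
    [DecidableRel H.Adj] (φ : G ≃g H) : degreeProfile G = degreeProfile H := by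
  refine Eq.symm ((Equiv.sum_comp φ.toEquiv _).symm.trans ?_)
  exact Finset.sum_congr rfl fun v _ => congrArg (10 ^ ·) (φ.sum_adj_eq v)

theorem isoClosed_profileProperty : IsoClosed profileProperty := by
  classical
  rintro G H ⟨φ⟩ hG
  rwa [mem_profileProperty, ← φ.degreeProfile_eq, ← mem_profileProperty]

theorem compl_mem_profileProperty {G : SimpleGraph (Fin 5)} (hG : G ∈ profileProperty) :
    Gᶜ ∈ profileProperty := by
  have h := codeTest_compl _ (graphCode_lt G) ((codeTest_graphCode G).2 hG)
  rwa [← mem_profileProperty, ofCode_graphCode] at h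

theorem exists_iso_classCode {G : SimpleGraph (Fin 5)} (hG : G ∈ profileProperty) :
    ∃ i, Nonempty (ofCode (classCode i) ≃g G) := by
  classical
  let σ := Tuple.sort fun v => OrderDual.toDual (∑ w, if G.Adj v w then 1 else 0)
  have hσ := Tuple.monotone_sort fun v => OrderDual.toDual (∑ w, if G.Adj v w then 1 else 0)
  obtain ⟨c, hc⟩ : ∃ c, c = graphCode (G.comap σ) := ⟨_, rfl⟩
  have hcode : ofCode c = G.comap σ := hc ▸ ofCode_graphCode _
  let φ : ofCode c ≃g G := ⟨σ, by rw [hcode]; rfl⟩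
  have hdeg (v : Fin 5) : (∑ w, if G.Adj (σ v) w then 1 else 0) =
      ∑ w, if (ofCode c).Adj v w then 1 else 0 := φ.sum_adj_eq v
  have htest : codeTest c = true :=
    (codeTest_iff c).2 (isoClosed_profileProperty _ _ ⟨φ.symm⟩ hG)
  obtain ⟨i, a, b, hab⟩ := exists_classCode_of_antitone c (hc ▸ graphCode_lt _) htest
    fun u v huv => by rw [← hdeg, ← hdeg]; exact hσ huv
  let ψ : ofCode c ≃g ofCode (classCode i) := ⟨Equiv.swap a b, hab _ _⟩
  exact ⟨i, ⟨ψ.symm.trans φ⟩⟩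

theorem card_classes_profileProperty :
    Nat.card (Quot fun G H : profileProperty =>
      Nonempty ((G : SimpleGraph (Fin 5)) ≃g (H : SimpleGraph (Fin 5)))) = 11 := by
  classical
  let rep (i : Fin 11) : profileProperty :=
    ⟨ofCode (classCode i), (codeTest_iff _).1 (codeTest_classCode i)⟩
  let key (G : profileProperty) : ℕ := degreeProfile G.1
  rw [← Nat.card_fin 11]
  refine (Nat.card_eq_of_bijective (fun i => Quot.mk _ (rep i)) ⟨fun i j hij => ?_, ?_⟩).symm
  · have hrep (i : Fin 11) : key (rep i) = degreeProfile (ofCode (classCode i)) :=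
      congrArg (fun inst => @degreeProfile (ofCode (classCode i)) inst) (Subsingleton.elim _ _)
    have h : key (rep i) = key (rep j) :=
      congrArg (Quot.lift key fun G H ⟨φ⟩ => φ.degreeProfile_eq) hij
    exact degreeProfile_classCode_injective ((hrep i).symm.trans (h.trans (hrep j)))
  · rintro ⟨G, hG⟩
    obtain ⟨i, hi⟩ := exists_iso_classCode hG
    exact ⟨i, Quot.sound hi⟩

/-- There exists a nontrivial nonevasive graph property on 5 vertices which is
closed under graph complementation and contains exactly 11 isomorphism classes. -/
theorem nonevasive_selfcomplementary_eleven_classes :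
    ∃ P : Set (SimpleGraph (Fin 5)), IsoClosed P ∧ P ≠ ∅ ∧ P ≠ Set.univ ∧
      (∃ t : EdgeTree 5, t.depth ≤ 9 ∧ t.Computes P) ∧
      (∀ G : SimpleGraph (Fin 5), G ∈ P ↔ Gᶜ ∈ P) ∧
      Nat.card (Quot (fun (G H : P) => Nonempty ((G : SimpleGraph (Fin 5)) ≃g (H : SimpleGraph (Fin 5))))) = 11 := by
  refine ⟨profileProperty, isoClosed_profileProperty, ?_, ?_,
    ⟨queryPlan.tree codeTest (List.finRange 10) 0, ?_, fun G => ?_⟩,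
    fun G => ⟨compl_mem_profileProperty, fun h => ?_⟩, card_classes_profileProperty⟩
  · exact Set.Nonempty.ne_empty ⟨_, (codeTest_iff _).1 (codeTest_classCode 0)⟩
  · refine (Set.ne_univ_iff_exists_notMem _).2 ⟨ofCode 0, ?_⟩
    rw [← codeTest_iff]
    decide
  · exact Nat.le_of_succ_le_succ (queryPlan.depth_tree queryPlan_check)
  · rw [queryPlan.eval_tree queryPlan_check, zero_add]
    exact codeTest_graphCode G
  · simpa using compl_mem_profileProperty h
end

section
/- Every nontrivial graph property on 3 vertices is evasive: if P is a set of simple graphs on 3 vertices, closed under isomorphism, with P ≠ ∅ and P ≠ univ, then every edge-query decision tree computing the indicator function of P has depth at least 3 = C(3,2). -/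
/-- The graph on three vertices in which `u` and `v` are adjacent exactly when the remaining
vertex `-(u + v)` belongs to `S`. -/
def graphOfOpposite (S : Finset (Fin 3)) : SimpleGraph (Fin 3) where
  Adj u v := u ≠ v ∧ -(u + v) ∈ S
  symm := ⟨fun u v h => ⟨h.1.symm, by rw [add_comm]; exact h.2⟩⟩
  loopless := ⟨fun _ h => h.1 rfl⟩

theorem graphOfOpposite_adj {S : Finset (Fin 3)} {u v : Fin 3} (huv : u ≠ v) :
    (graphOfOpposite S).Adj u v ↔ -(u + v) ∈ S :=
  and_iff_right huv

theorem exists_graphOfOpposite_eq (G : SimpleGraph (Fin 3)) : ∃ S, graphOfOpposite S = G := by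
  classical
  refine ⟨Finset.univ.filter fun w => G.Adj (w + 1) (w + 2), ?_⟩
  ext u v
  rcases eq_or_ne u v with rfl | huv
  · simp
  · have h : s(-(u + v) + 1, -(u + v) + 2) = s(u, v) := by
      revert u v
      decide
    rw [graphOfOpposite_adj huv, Finset.mem_filter_univ, ← G.mem_edgeSet, h, G.mem_edgeSet]

theorem neg_perm_add_perm (σ : Equiv.Perm (Fin 3)) {u v : Fin 3} (huv : u ≠ v) :
    -(σ u + σ v) = σ (-(u + v)) := by
  revert σ u v
  decide

theorem graphOfOpposite_iso_of_card_eq {S T : Finset (Fin 3)} (h : S.card = T.card) :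
    Nonempty (graphOfOpposite S ≃g graphOfOpposite T) := by
  obtain ⟨σ, hσ⟩ : ∃ σ : Equiv.Perm (Fin 3), ∀ w, σ w ∈ T ↔ w ∈ S := by
    revert S T
    decide
  refine ⟨⟨σ, fun {u v} => ?_⟩⟩
  rcases eq_or_ne u v with rfl | huv
  · simp
  · rw [graphOfOpposite_adj (σ.injective.ne huv), graphOfOpposite_adj huv,
      neg_perm_add_perm σ huv, hσ]

theorem EdgeTree.eval_node_graphOfOpposite {u v : Fin 3} (huv : u ≠ v) (tYes tNo : EdgeTree 3)
    (S : Finset (Fin 3)) :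
    (EdgeTree.node u v huv tYes tNo).eval (graphOfOpposite S) =
      if -(u + v) ∈ S then tYes.eval (graphOfOpposite S) else tNo.eval (graphOfOpposite S) := by
  simp only [EdgeTree.eval, graphOfOpposite_adj huv]

/-- A tree making at most one query ignores some edge other than any prescribed one. -/
theorem EdgeTree.exists_ne_eval_insert_eq (p : Fin 3) {t : EdgeTree 3} (ht : t.depth ≤ 1) :
    ∃ r, r ≠ p ∧ ∀ S, t.eval (graphOfOpposite (insert r S)) = t.eval (graphOfOpposite S) := by
  match t with
  | .leaf b => exact ⟨p + 1, by simp, fun _ => rfl⟩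
  | .node u v huv (.leaf b) (.leaf c) =>
    obtain ⟨r, hrp, hrq⟩ : ∃ r, r ≠ p ∧ r ≠ -(u + v) := by
      generalize -(u + v) = q
      revert p q
      decide
    refine ⟨r, hrp, fun S => ?_⟩
    simp only [eval_node_graphOfOpposite, Finset.mem_insert, hrq.symm, false_or]
    rfl
  | .node _ _ _ (.node ..) _ => simp [EdgeTree.depth] at ht
  | .node _ _ _ _ (.node ..) => simp [EdgeTree.depth] at ht

/-- A tree of depth at most two cannot tell apart some pair of graphs with `k` and `k + 1` edges,
for each `k < 3`. -/
theorem EdgeTree.exists_eval_eq_of_depth_le_two {t : EdgeTree 3} (ht : t.depth ≤ 2) {k : ℕ}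
    (hk : k < 3) :
    ∃ S T : Finset (Fin 3), S.card = k ∧ T.card = k + 1 ∧
      t.eval (graphOfOpposite T) = t.eval (graphOfOpposite S) := by
  cases t with
  | leaf b =>
    obtain ⟨S, -, hS⟩ := Finset.exists_subset_card_eq (s := (Finset.univ : Finset (Fin 3)))
      (n := k) (by simp; omega)
    obtain ⟨T, -, hT⟩ := Finset.exists_subset_card_eq (s := (Finset.univ : Finset (Fin 3)))
      (n := k + 1) (by simp; omega)
    exact ⟨S, T, hS, hT, rfl⟩
  | node u v huv tYes tNo =>
    simp only [EdgeTree.depth] at ht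
    set p := -(u + v) with hp
    obtain ⟨r, hrp, hr⟩ := exists_ne_eval_insert_eq p (t := tYes) (by omega)
    obtain ⟨s, hsp, hs⟩ := exists_ne_eval_insert_eq p (t := tNo) (by omega)
    interval_cases k
    · refine ⟨∅, insert s ∅, by simp, by simp, ?_⟩
      rw [eval_node_graphOfOpposite, eval_node_graphOfOpposite, ← hp, hs]
      simp [hsp.symm]
    · refine ⟨{p}, insert r {p}, by simp, Finset.card_pair hrp, ?_⟩
      simp [eval_node_graphOfOpposite, ← hp, hr]
    · refine ⟨Finset.univ.erase r, insert r (Finset.univ.erase r), by simp, by simp, ?_⟩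
      rw [eval_node_graphOfOpposite, eval_node_graphOfOpposite, ← hp, hr]
      simp [hrp.symm]

/-- Every nontrivial graph property on 3 vertices is evasive: every decision
tree computing it has depth at least 3 = C(3,2). -/
theorem three_vertices_evasive (P : Set (SimpleGraph (Fin 3)))
    (hiso : IsoClosed P) (hne : P ≠ ∅) (hnu : P ≠ Set.univ)
    (t : EdgeTree 3) (ht : t.Computes P) : 3 ≤ t.depth := by
  by_contra! hd
  have mem_iff_of_card {S T : Finset (Fin 3)} (h : S.card = T.card) :
      graphOfOpposite S ∈ P ↔ graphOfOpposite T ∈ P :=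
    ⟨hiso _ _ (graphOfOpposite_iso_of_card_eq h),
      hiso _ _ (graphOfOpposite_iso_of_card_eq h.symm)⟩
  have mem_iff_empty : ∀ k ≤ 3, ∀ S : Finset (Fin 3), S.card = k →
      (graphOfOpposite S ∈ P ↔ graphOfOpposite ∅ ∈ P) := by
    intro k
    induction k with
    | zero => exact fun _ S hS => mem_iff_of_card hS
    | succ k ih =>
      intro hk S hS
      obtain ⟨A, B, hA, hB, hAB⟩ :=
        EdgeTree.exists_eval_eq_of_depth_le_two (t := t) (by omega) (k := k) (by omega)
      rw [mem_iff_of_card (hS.trans hB.symm), ← ht, hAB, ht, ih (by omega) A hA]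
  have mem_iff (G : SimpleGraph (Fin 3)) : G ∈ P ↔ graphOfOpposite ∅ ∈ P := by
    obtain ⟨S, rfl⟩ := exists_graphOfOpposite_eq G
    exact mem_iff_empty _ (card_finset_fin_le S) S rfl
  by_cases h : graphOfOpposite ∅ ∈ P
  · exact hnu (Set.eq_univ_of_forall fun G => (mem_iff G).2 h)
  · exact hne (Set.eq_empty_of_forall_notMem fun G hG => h ((mem_iff G).1 hG))
end
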